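/- arXiv:2412.01012 — 6 statements merged into one kernel-verified Lean document; each statement's English description precedes it below -/
import Mathlib

section
/- Let X be a Polish space, μ and ν Borel probability measures on X, and π a coupling of μ and ν. Let R ⊆ X × X be a Borel set with π(R) = 1, and let A, B ⊆ X be Borel sets such that {x ∈ X : ∃ y ∈ A, (x,y) ∈ R} ⊆ B and ν(A) = μ(B). Then the restricted measure π↾(B × A) (the measure E ↦ π(E ∩ (B × A))) is a coupling of the restricted measures μ↾B and ν↾A; that is, its first marginal is μ↾B and its second marginal is ν↾A. -/
open MeasureTheory
open scoped ENNReal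

/-- If a coupling `π` of `μ, ν` is concentrated on a Borel set `R`,
`A, B` are Borel sets with `{x | ∃ y ∈ A, (x,y) ∈ R} ⊆ B` and `ν A = μ B`, then the
restriction of `π` to `B ×ˢ A` is a coupling of `μ.restrict B` and `ν.restrict A`. -/
theorem restricted_coupling
    {X : Type*} [TopologicalSpace X] [PolishSpace X] [MeasurableSpace X] [BorelSpace X]
    (μ ν : Measure X) [IsProbabilityMeasure μ] [IsProbabilityMeasure ν]
    (π : Measure (X × X)) [IsProbabilityMeasure π]
    (hπ1 : π.map Prod.fst = μ) (hπ2 : π.map Prod.snd = ν)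
    (R : Set (X × X)) (hR : MeasurableSet R) (hRfull : π R = 1)
    (A B : Set X) (hA : MeasurableSet A) (hB : MeasurableSet B)
    (hsub : {x : X | ∃ y ∈ A, (x, y) ∈ R} ⊆ B)
    (hAB : ν A = μ B) :
    (π.restrict (B ×ˢ A)).map Prod.fst = μ.restrict B ∧
      (π.restrict (B ×ˢ A)).map Prod.snd = ν.restrict A := by
  have hAm : MeasurableSet (Prod.snd ⁻¹' A : Set (X × X)) := measurable_snd hA
  have hBm : MeasurableSet (Prod.fst ⁻¹' B : Set (X × X)) := measurable_fst hB
  have hRae : ∀ᵐ p ∂π, p ∈ R := (prob_compl_eq_zero_iff hR).2 hRfull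
  have hle : (Prod.snd ⁻¹' A : Set (X × X)) ≤ᵐ[π] (Prod.fst ⁻¹' B : Set (X × X)) := by
    filter_upwards [hRae] with p hp
    intro hpA
    exact hsub ⟨p.2, hpA, hp⟩
  have hmeas : π (Prod.fst ⁻¹' B) ≤ π (Prod.snd ⁻¹' A) := by
    rw [← Measure.map_apply measurable_fst hB, ← Measure.map_apply measurable_snd hA,
      hπ1, hπ2, hAB]
  have heq : (Prod.snd ⁻¹' A : Set (X × X)) =ᵐ[π] (Prod.fst ⁻¹' B : Set (X × X)) :=
    ae_eq_of_ae_subset_of_measure_ge hle hmeas hAm.nullMeasurableSet (measure_ne_top _ _)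
  have h2 : (B ×ˢ A : Set (X × X)) =ᵐ[π] (Prod.snd ⁻¹' A : Set (X × X)) := by
    rw [Set.prod_eq]
    have h := heq.symm.inter (Filter.EventuallyEq.refl _ (Prod.snd ⁻¹' A : Set (X × X)))
    rwa [Set.inter_self] at h
  have h1 := h2.trans heq
  constructor
  · rw [Measure.restrict_congr_set h1, ← Measure.restrict_map measurable_fst hB, hπ1]
  · rw [Measure.restrict_congr_set h2, ← Measure.restrict_map measurable_snd hA, hπ2]
end

section
/- Let a, b ∈ ℝ with a < b, let ε > 0, and let B ⊆ [a,b] be a Borel measurable set with Lebesgue measure ℒ¹(B) ≥ ε(b − a). Then for every natural number k ≥ 1 there exist points t₁ < t₂ < ... < t_k, all belonging to B, such that t_{i+1} − t_i ≥ (ε/(2k))·(b − a) for every i = 1, ..., k − 1. -/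
open MeasureTheory

theorem chain_aux (d : ℝ) (hd : 0 < d) (n : ℕ) : ∀ B : Set ℝ, BddBelow B →
    ENNReal.ofReal (n * (2 * d)) < volume B →
    ∃ t : ℕ → ℝ, (∀ i ≤ n, t i ∈ B) ∧ (∀ i < n, d ≤ t (i + 1) - t i) := by
  induction n with
  | zero =>
    intro B _ h
    have hne : B.Nonempty := by
      rw [Set.nonempty_iff_ne_empty]
      rintro rfl
      simp at h
    obtain ⟨x, hx⟩ := hne
    exact ⟨fun _ => x, fun _ _ => hx, fun i hi => absurd hi (Nat.not_lt_zero i)⟩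
  | succ n ih =>
    intro B hb h
    have hne : B.Nonempty := by
      rw [Set.nonempty_iff_ne_empty]
      rintro rfl
      simp at h
    obtain ⟨x, hx, hxd⟩ := exists_lt_of_csInf_lt hne (lt_add_of_pos_right (sInf B) hd)
    have hsub : B ⊆ Set.Icc (sInf B) (sInf B + 2 * d) ∪ (B ∩ Set.Ici (x + d)) := by
      intro y hy
      have hy1 := csInf_le hb hy
      by_cases hc : x + d ≤ y
      · exact Or.inr ⟨hy, hc⟩
      · exact Or.inl ⟨hy1, by linarith⟩
    have hle := (measure_mono hsub).trans (measure_union_le (μ := volume) _ _)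
    rw [Real.volume_Icc, add_sub_cancel_left] at hle
    have hlt : ENNReal.ofReal (n * (2 * d)) < volume (B ∩ Set.Ici (x + d)) := by
      by_contra hc
      rw [not_lt] at hc
      have h2 := hle.trans (add_le_add_right hc _)
      rw [← ENNReal.ofReal_add (by positivity) (by positivity)] at h2
      refine absurd (h.trans_le h2) (not_lt.mpr (ENNReal.ofReal_le_ofReal ?_))
      push_cast
      linarith
    obtain ⟨t, ht, hg⟩ := ih _ (hb.mono Set.inter_subset_left) hlt
    refine ⟨fun i => Nat.casesOn i x t, ?_, ?_⟩
    · rintro (_ | i) hi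
      · exact hx
      · exact (ht i (by omega)).1
    · rintro (_ | i) hi
      · have := (ht 0 (by omega)).2
        simp only [Set.mem_Ici] at this
        show d ≤ t 0 - x
        linarith
      · exact hg i (by omega)


/-- If `B ⊆ [a,b]` is Borel with Lebesgue measure at least `ε(b-a)`,
then for every `k ≥ 1` one can select `k` points `t₁ < ... < t_k` in `B` with
consecutive gaps at least `(ε/(2k))(b-a)`. -/
theorem finite_chain_selection
    (a b : ℝ) (hab : a < b) (ε : ℝ) (hε : 0 < ε)
    (B : Set ℝ) (hB : MeasurableSet B) (hBsub : B ⊆ Set.Icc a b)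
    (hmeas : ENNReal.ofReal (ε * (b - a)) ≤ volume B)
    (k : ℕ) (hk : 1 ≤ k) :
    ∃ t : ℕ → ℝ, (∀ i < k, t i ∈ B) ∧
      (∀ i j, i < j → j < k → t i < t j) ∧
      (∀ i, i + 1 < k → ε / (2 * k) * (b - a) ≤ t (i + 1) - t i) := by
  have hba : 0 < b - a := sub_pos.mpr hab
  have hk0 : (0 : ℝ) < k := by exact_mod_cast hk
  have hd : 0 < ε / (2 * k) * (b - a) := by positivity
  have hlt : ENNReal.ofReal (((k - 1 : ℕ) : ℝ) * (2 * (ε / (2 * k) * (b - a)))) < volume B := by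
    refine lt_of_lt_of_le ?_ hmeas
    rw [ENNReal.ofReal_lt_ofReal_iff (by positivity)]
    have e : ε * (b - a) = k * (2 * (ε / (2 * k) * (b - a))) := by field_simp
    rw [e, Nat.cast_sub hk]
    push_cast
    linarith
  obtain ⟨t, ht, hg⟩ := chain_aux _ hd (k - 1) B (bddBelow_Icc.mono hBsub) hlt
  refine ⟨t, fun i hi => ht i (by omega), ?_, fun i hi => hg i (by omega)⟩
  intro i j hij
  induction j, hij using Nat.le_induction with
  | base =>
    intro hj
    have := hg i (by omega)
    linarith
  | succ j hj ihj =>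
    intro hjk
    have h1 := ihj (by omega)
    have := hg j (by omega)
    linarith
end

section
/- Let n ≥ 1, let S ⊆ ℝⁿ, and let α ∈ (0,1). Suppose that for every x ∈ S there exists a unit vector v_x ∈ ℝⁿ such that the tangent cone T_xS is contained in ℝⁿ \ Cone(v_x, α), i.e. T_xS ∩ Cone(v_x, α) = ∅. Then S is countably (n−1)-rectifiable. -/
open scoped RealInnerProductSpace
open Filter

/-- The open cone around a unit vector `v` with angle `α`:
all nonzero `w` with `⟪v, w/‖w‖⟫ > α`. -/
def euclCone {n : ℕ} (v : EuclideanSpace ℝ (Fin n)) (α : ℝ) :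
    Set (EuclideanSpace ℝ (Fin n)) :=
  {w | w ≠ 0 ∧ α * ‖w‖ < ⟪v, w⟫}

/-- The tangent cone to `S` at `x`: all limits of `(x_k - x)/t_k` with `x_k ∈ S`,
`x_k → x`, `t_k > 0`, `t_k → 0`. -/
def tangentConeOf {n : ℕ} (S : Set (EuclideanSpace ℝ (Fin n)))
    (x : EuclideanSpace ℝ (Fin n)) : Set (EuclideanSpace ℝ (Fin n)) :=
  {u | ∃ (xs : ℕ → EuclideanSpace ℝ (Fin n)) (t : ℕ → ℝ),
    (∀ k, xs k ∈ S) ∧ (∀ k, 0 < t k) ∧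
    Tendsto xs atTop (nhds x) ∧ Tendsto t atTop (nhds 0) ∧
    Tendsto (fun k => (t k)⁻¹ • (xs k - x)) atTop (nhds u)}

/-- A set `S ⊆ ℝⁿ` is countably `(n-1)`-rectifiable if it is covered by countably many
Lipschitz images of subsets of `ℝ^{n-1}`. -/
def CountablyRectifiable (n : ℕ) (S : Set (EuclideanSpace ℝ (Fin n))) : Prop :=
  ∃ (D : ℕ → Set (EuclideanSpace ℝ (Fin (n - 1))))
    (f : ℕ → EuclideanSpace ℝ (Fin (n - 1)) → EuclideanSpace ℝ (Fin n)),
    (∀ k, ∃ K : NNReal, LipschitzOnWith K (f k) (D k)) ∧ S ⊆ ⋃ k, f k '' D k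

open Metric in
lemma aux_local {n : ℕ} (S : Set (EuclideanSpace ℝ (Fin n))) (α β : ℝ) (hαβ : α < β)
    (x v : EuclideanSpace ℝ (Fin n))
    (h : tangentConeOf S x ∩ euclCone v α = ∅) :
    ∃ m : ℕ, ∀ y ∈ S, ‖y - x‖ < 1 / ((m : ℝ) + 1) → ⟪v, y - x⟫ ≤ β * ‖y - x‖ := by
  by_contra hcon
  push Not at hcon
  choose y hyS hyd hyc using hcon
  have hpos : ∀ m, 0 < ‖y m - x‖ := by
    intro m
    rw [norm_pos_iff]
    intro h0
    have := hyc m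
    rw [h0] at this
    simp at this
  have ht : Tendsto (fun m => ‖y m - x‖) atTop (nhds 0) :=
    squeeze_zero (fun m => norm_nonneg _) (fun m => (hyd m).le)
      tendsto_one_div_add_atTop_nhds_zero_nat
  have hy : Tendsto y atTop (nhds x) := tendsto_iff_norm_sub_tendsto_zero.2 ht
  have hs : ∀ m, ‖y m - x‖⁻¹ • (y m - x) ∈ sphere (0 : EuclideanSpace ℝ (Fin n)) 1 := by
    intro m
    rw [mem_sphere_zero_iff_norm, norm_smul, norm_inv, norm_norm]
    exact inv_mul_cancel₀ (hpos m).ne'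
  obtain ⟨u, hu, φ, hφ, hlim⟩ := (isCompact_sphere (0 : EuclideanSpace ℝ (Fin n)) 1).tendsto_subseq hs
  have hu1 : ‖u‖ = 1 := by simpa using hu
  have hin : β ≤ ⟪v, u⟫ := by
    have h1 : Tendsto (fun k => ⟪v, ‖y (φ k) - x‖⁻¹ • (y (φ k) - x)⟫) atTop (nhds ⟪v, u⟫) :=
      tendsto_const_nhds.inner hlim
    refine ge_of_tendsto' h1 (fun k => ?_)
    rw [inner_smul_right, inv_mul_eq_div, le_div_iff₀ (hpos _)]
    exact (hyc _).le
  have : u ∈ tangentConeOf S x ∩ euclCone v α := by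
    refine ⟨⟨y ∘ φ, fun k => ‖y (φ k) - x‖, fun k => hyS _, fun k => hpos _,
      hy.comp hφ.tendsto_atTop, ht.comp hφ.tendsto_atTop, hlim⟩, ?_, ?_⟩
    · intro h0
      simp [h0] at hu1
    · rw [hu1]; linarith
  rw [h] at this
  exact this

lemma aux_piece {n : ℕ} (P : Set (EuclideanSpace ℝ (Fin (n + 1)))) (γ : ℝ) (hγ : 0 < γ)
    (d : EuclideanSpace ℝ (Fin (n + 1))) (hd : γ < ‖d‖)
    (hP : ∀ x ∈ P, ∀ y ∈ P, ⟪d, y - x⟫ ≤ γ * ‖y - x‖) :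
    ∃ (D : Set (EuclideanSpace ℝ (Fin n)))
      (f : EuclideanSpace ℝ (Fin n) → EuclideanSpace ℝ (Fin (n + 1))) (K : NNReal),
      LipschitzOnWith K f D ∧ P ⊆ f '' D := by
  classical
  have hd0 : 0 < ‖d‖ := hγ.trans hd
  have hdne : d ≠ 0 := norm_pos_iff.1 hd0
  have : Fact (Module.finrank ℝ (EuclideanSpace ℝ (Fin (n + 1))) = n + 1) := ⟨by simp⟩
  let b := OrthonormalBasis.fromOrthogonalSpanSingleton (𝕜 := ℝ) n hdne
  let L : EuclideanSpace ℝ (Fin (n + 1)) → EuclideanSpace ℝ (Fin n) :=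
    fun w => b.repr ((ℝ ∙ d)ᗮ.orthogonalProjectionOnto w)
  have hL : ∀ x y, ‖L x - L y‖ = ‖(ℝ ∙ d)ᗮ.orthogonalProjectionOnto (x - y)‖ := by
    intro x y
    simp only [L]
    rw [← map_sub, ← map_sub, LinearIsometryEquiv.norm_map]
  set c : ℝ := 1 - (γ / ‖d‖) ^ 2 with hc
  have hc0 : 0 < c := by
    have : γ / ‖d‖ < 1 := (div_lt_one hd0).2 hd
    have h2 : 0 < γ / ‖d‖ := by positivity
    nlinarith
  have key : ∀ x ∈ P, ∀ y ∈ P, c * ‖x - y‖ ^ 2 ≤ ‖L x - L y‖ ^ 2 := by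
    intro x hx y hy
    rw [hL]
    have h1 := Submodule.norm_sq_eq_add_norm_sq_projection (x - y) (ℝ ∙ d)
    have h2 : ‖(ℝ ∙ d).orthogonalProjectionOnto (x - y)‖ = |⟪d, x - y⟫| / ‖d‖ := by
      rw [Submodule.coe_norm, ← Submodule.starProjection_apply, Submodule.starProjection_singleton, norm_smul]
      simp
      field_simp
    have h3 : |⟪d, x - y⟫| ≤ γ * ‖x - y‖ := by
      rw [abs_le]
      refine ⟨?_, hP y hy x hx⟩
      have := hP x hx y hy
      rw [← neg_sub x y, inner_neg_right, norm_neg] at this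
      linarith
    have h4 : (|⟪d, x - y⟫| / ‖d‖) ^ 2 ≤ (γ / ‖d‖) ^ 2 * ‖x - y‖ ^ 2 := by
      rw [← mul_pow, div_mul_eq_mul_div]
      gcongr
    rw [h2] at h1
    rw [hc]
    linarith
  have key2 : ∀ x ∈ P, ∀ y ∈ P, ‖x - y‖ ≤ (Real.sqrt c)⁻¹ * ‖L x - L y‖ := by
    intro x hx y hy
    have hs := Real.sqrt_pos.2 hc0
    rw [inv_mul_eq_div, le_div_iff₀ hs]
    apply le_of_sq_le_sq _ (norm_nonneg _)
    rw [mul_pow, Real.sq_sqrt hc0.le, mul_comm]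
    exact key x hx y hy
  have hinj : Set.InjOn L P := by
    intro x hx y hy hxy
    have := key2 x hx y hy
    rw [hxy, sub_self, norm_zero, mul_zero] at this
    exact sub_eq_zero.1 (norm_le_zero_iff.1 this)
  have hinv := hinj.leftInvOn_invFunOn
  refine ⟨L '' P, Function.invFunOn L P, (Real.sqrt c)⁻¹.toNNReal, ?_, ?_⟩
  · apply LipschitzOnWith.of_dist_le_mul
    rintro _ ⟨x, hx, rfl⟩ _ ⟨y, hy, rfl⟩
    rw [hinv hx, hinv hy, dist_eq_norm, dist_eq_norm, Real.coe_toNNReal _ (by positivity)]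
    exact key2 x hx y hy
  · intro x hx
    exact ⟨L x, ⟨x, hx, rfl⟩, hinv hx⟩

/-- If at every point `x ∈ S` the tangent cone avoids a fixed-angle
open cone `Cone(v_x, α)` around some unit vector `v_x`, then `S` is countably
`(n-1)`-rectifiable. -/
theorem rectifiable_of_tangent_cone_avoids_cone
    {n : ℕ} (hn : 1 ≤ n) (S : Set (EuclideanSpace ℝ (Fin n)))
    (α : ℝ) (hα0 : 0 < α) (hα1 : α < 1)
    (h : ∀ x ∈ S, ∃ v : EuclideanSpace ℝ (Fin n), ‖v‖ = 1 ∧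
      tangentConeOf S x ∩ euclCone v α = ∅) :
    CountablyRectifiable n S := by
  obtain ⟨n, rfl⟩ : ∃ m, n = m + 1 := ⟨n - 1, by omega⟩
  obtain ⟨ε, hε⟩ : ∃ ε : ℝ, ε = (1 - α) / 4 := ⟨_, rfl⟩
  have hε0 : 0 < ε := by rw [hε]; linarith
  let q := TopologicalSpace.denseSeq (EuclideanSpace ℝ (Fin (n + 1)))
  have hq : DenseRange q := TopologicalSpace.denseRange_denseSeq _
  let P : ℕ × ℕ × ℕ → Set (EuclideanSpace ℝ (Fin (n + 1))) := fun i =>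
    {x | x ∈ S ∧ α + 2 * ε < ‖q i.2.1‖ ∧ dist x (q i.2.2) < 1 / ((i.1 : ℝ) + 1) / 2 ∧
      ∀ y ∈ S, ‖y - x‖ < 1 / ((i.1 : ℝ) + 1) → ⟪q i.2.1, y - x⟫ ≤ (α + 2 * ε) * ‖y - x‖}
  have hpiece : ∀ i, ∃ (D : Set (EuclideanSpace ℝ (Fin n)))
      (f : EuclideanSpace ℝ (Fin n) → EuclideanSpace ℝ (Fin (n + 1))) (K : NNReal),
      LipschitzOnWith K f D ∧ P i ⊆ f '' D := by
    intro i
    by_cases hi : α + 2 * ε < ‖q i.2.1‖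
    · refine aux_piece (P i) (α + 2 * ε) (by linarith) (q i.2.1) hi ?_
      rintro x ⟨hx, -, hxd, hxc⟩ y ⟨hy, -, hyd, -⟩
      apply hxc y hy
      rw [← dist_eq_norm]
      have := dist_triangle_right y x (q i.2.2)
      linarith
    · exact ⟨∅, fun _ => 0, 0, by simp, fun x hx => (hi hx.2.1).elim⟩
  choose D f K hK hPf using hpiece
  let e := Denumerable.eqv (ℕ × ℕ × ℕ)
  refine ⟨fun k => D (e.symm k), fun k => f (e.symm k), fun k => ⟨_, hK _⟩, ?_⟩
  intro x hx
  obtain ⟨v, hv, hvc⟩ := h x hx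
  obtain ⟨m, hm⟩ := aux_local S α (α + ε) (by linarith) x v hvc
  obtain ⟨i, hi⟩ := hq.exists_dist_lt v hε0
  obtain ⟨j, hj⟩ := hq.exists_dist_lt x (show 0 < 1 / ((m : ℝ) + 1) / 2 by positivity)
  rw [dist_eq_norm] at hi
  have hxP : x ∈ P (m, i, j) := by
    refine ⟨hx, ?_, hj, ?_⟩
    · have := norm_sub_norm_le v (q i)
      show α + 2 * ε < ‖q i‖
      linarith
    · intro y hy hyx
      have h1 := hm y hy hyx
      have h2 := real_inner_le_norm (q i - v) (y - x)
      rw [inner_sub_left, norm_sub_rev] at h2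
      have h3 : ‖v - q i‖ * ‖y - x‖ ≤ ε * ‖y - x‖ := by gcongr
      show ⟪q i, y - x⟫ ≤ (α + 2 * ε) * ‖y - x‖
      linarith
  refine Set.mem_iUnion.2 ⟨e (m, i, j), ?_⟩
  simp only [Equiv.symm_apply_apply]
  exact hPf _ hxP
end

section
/- Let n ≥ 1 and S ⊆ ℝⁿ, and suppose there exists r > 0 with the following property: for each x ∈ S there exist t_x > 0 and a vector v_x ∈ ℝⁿ such that the open ball x + B_{tr}(t v_x) (centered at x + t v_x of radius t r) is contained in the complement of S for all 0 < t ≤ t_x. Then S is countably (n−1)-rectifiable. -/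
lemma exists_proj {n : ℕ} (hn : 1 ≤ n) (q : EuclideanSpace ℝ (Fin n)) (hq : q ≠ 0) :
    ∃ P : EuclideanSpace ℝ (Fin n) →ₗ[ℝ] EuclideanSpace ℝ (Fin (n - 1)),
      ∀ z, ∃ s : ℝ, ‖z - s • q‖ = ‖P z‖ ∧ |s| * ‖q‖ ≤ ‖z‖ := by
  have : Fact (Module.finrank ℝ (EuclideanSpace ℝ (Fin n)) = (n - 1) + 1) :=
    ⟨by rw [finrank_euclideanSpace_fin]; omega⟩
  let b := OrthonormalBasis.fromOrthogonalSpanSingleton (𝕜 := ℝ) (n - 1) hq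
  refine ⟨b.repr.toLinearEquiv.toLinearMap ∘ₗ
    ((Submodule.span ℝ {q})ᗮ.orthogonalProjectionOnto).toLinearMap, fun z => ?_⟩
  have hmem := (Submodule.span ℝ {q}).starProjection_apply_mem z
  obtain ⟨s, hs⟩ := Submodule.mem_span_singleton.1 hmem
  refine ⟨s, ?_, ?_⟩
  · have h1 : z - s • q = (((Submodule.span ℝ {q})ᗮ.orthogonalProjectionOnto z :
        (Submodule.span ℝ {q})ᗮ) : EuclideanSpace ℝ (Fin n)) := by
      rw [hs, ← Submodule.starProjection_apply, Submodule.starProjection_orthogonal_val]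
    rw [h1]
    simp
  · rw [← Real.norm_eq_abs, ← norm_smul, hs]
    exact Submodule.norm_starProjection_apply_le _ z

lemma exists_piece {n : ℕ} (hn : 1 ≤ n) (S A : Set (EuclideanSpace ℝ (Fin n)))
    (q : EuclideanSpace ℝ (Fin n)) (ρ δ : ℝ) (hρ : 0 < ρ) (hδ : 0 < δ) (hAS : A ⊆ S)
    (hA : ∀ x ∈ A, ∀ t : ℝ, 0 < t → t ≤ δ → Metric.ball (x + t • q) (t * ρ) ⊆ Sᶜ)
    (hd : ∀ x ∈ A, ∀ y ∈ A, dist x y ≤ δ * ‖q‖) :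
    ∃ (D : Set (EuclideanSpace ℝ (Fin (n - 1))))
      (f : EuclideanSpace ℝ (Fin (n - 1)) → EuclideanSpace ℝ (Fin n)),
      (∃ K : NNReal, LipschitzOnWith K f D) ∧ A ⊆ f '' D := by
  by_cases hq : q = 0
  · refine ⟨∅, fun _ => 0, ⟨0, by simp⟩, fun x hx => ?_⟩
    exfalso
    refine hA x hx δ hδ le_rfl ?_ (hAS hx)
    simp [hq]; positivity
  have hq' : 0 < ‖q‖ := norm_pos_iff.2 hq
  obtain ⟨P, hP⟩ := exists_proj hn q hq
  have key0 : ∀ x ∈ A, ∀ y ∈ A, ∀ s : ℝ, 0 < s → s * ‖q‖ ≤ ‖y - x‖ →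
      s * ρ ≤ ‖y - x - s • q‖ := by
    intro x hx y hy s hs hle
    by_contra! hlt
    have hsd : s ≤ δ := by
      have := hd y hy x hx
      rw [dist_eq_norm] at this
      exact le_of_mul_le_mul_right (hle.trans this) hq'
    refine hA x hx s hs hsd ?_ (hAS hy)
    rw [Metric.mem_ball, dist_eq_norm, ← sub_sub]
    exact hlt
  have key : ∀ x ∈ A, ∀ y ∈ A, ‖y - x‖ ≤ (‖q‖ / ρ + 1) * ‖P y - P x‖ := by
    intro x hx y hy
    obtain ⟨s, h1, h2⟩ := hP (y - x)
    rw [map_sub] at h1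
    have h3 : |s| * ρ ≤ ‖P y - P x‖ := by
      rw [← h1]
      rcases lt_trichotomy s 0 with h | h | h
      · rw [abs_of_neg h] at h2 ⊢
        have := key0 y hy x hx (-s) (by linarith) (by rwa [norm_sub_rev])
        refine this.trans (le_of_eq ?_)
        rw [← norm_neg]; congr 1; module
      · simp [h]
      · rw [abs_of_pos h] at h2 ⊢
        exact key0 x hx y hy s h h2
    have h4 : ‖y - x‖ ≤ ‖y - x - s • q‖ + |s| * ‖q‖ := by
      rw [← Real.norm_eq_abs, ← norm_smul]
      simpa using norm_add_le (y - x - s • q) (s • q)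
    have h5 : |s| ≤ ‖P y - P x‖ / ρ := by rwa [le_div_iff₀ hρ]
    have h6 := mul_le_mul_of_nonneg_right h5 hq'.le
    calc ‖y - x‖ ≤ _ := h4
      _ ≤ ‖P y - P x‖ + ‖P y - P x‖ / ρ * ‖q‖ := by rw [h1]; linarith
      _ = _ := by ring
  have hinj : Set.InjOn P A := by
    intro x hx y hy hxy
    have := key y hy x hx
    rw [hxy] at this
    simpa [sub_eq_zero] using this
  refine ⟨P '' A, Function.invFunOn P A, ⟨⟨‖q‖ / ρ + 1, by positivity⟩, ?_⟩, ?_⟩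
  · refine LipschitzOnWith.of_dist_le_mul ?_
    rintro _ ⟨x, hx, rfl⟩ _ ⟨y, hy, rfl⟩
    rw [hinj.leftInvOn_invFunOn hx, hinj.leftInvOn_invFunOn hy, dist_eq_norm, dist_eq_norm]
    exact key y hy x hx
  · intro x hx
    exact ⟨P x, ⟨x, hx, rfl⟩, hinj.leftInvOn_invFunOn hx⟩

/-- If there is `r > 0` such that every `x ∈ S` admits `t_x > 0` and a
vector `v_x` with the ball `x + B_{tr}(t v_x)` contained in the complement of `S` for all
`0 < t ≤ t_x`, then `S` is countably `(n-1)`-rectifiable. -/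
theorem rectifiable_of_escaping_balls
    {n : ℕ} (hn : 1 ≤ n) (S : Set (EuclideanSpace ℝ (Fin n)))
    (r : ℝ) (hr : 0 < r)
    (h : ∀ x ∈ S, ∃ tx : ℝ, 0 < tx ∧ ∃ v : EuclideanSpace ℝ (Fin n),
      ∀ t : ℝ, 0 < t → t ≤ tx → Metric.ball (x + t • v) (t * r) ⊆ Sᶜ) :
    CountablyRectifiable n S := by
  let d := TopologicalSpace.denseSeq (EuclideanSpace ℝ (Fin n))
  have hdense : ∀ x : EuclideanSpace ℝ (Fin n), ∀ ε > 0, ∃ i, dist x (d i) < ε := fun x ε hε =>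
    (TopologicalSpace.denseRange_denseSeq (EuclideanSpace ℝ (Fin n))).exists_dist_lt x hε
  let A : ℕ × ℕ × ℕ → Set (EuclideanSpace ℝ (Fin n)) := fun p =>
    {x | x ∈ S ∧ (∀ t : ℝ, 0 < t → t ≤ 1 / ((p.2.1 : ℝ) + 1) →
        Metric.ball (x + t • d p.1) (t * (r / 2)) ⊆ Sᶜ) ∧
      dist x (d p.2.2) ≤ 1 / ((p.2.1 : ℝ) + 1) * ‖d p.1‖ / 2}
  have hpiece : ∀ p, ∃ (D : Set (EuclideanSpace ℝ (Fin (n - 1))))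
      (f : EuclideanSpace ℝ (Fin (n - 1)) → EuclideanSpace ℝ (Fin n)),
      (∃ K : NNReal, LipschitzOnWith K f D) ∧ A p ⊆ f '' D := by
    intro p
    refine exists_piece hn S (A p) (d p.1) (r / 2) (1 / ((p.2.1 : ℝ) + 1)) (by positivity)
      (by positivity) (fun x hx => hx.1) (fun x hx => hx.2.1) ?_
    intro x hx y hy
    have h1 := hx.2.2
    have h2 := hy.2.2
    have h3 := dist_triangle_right x y (d p.2.2)
    linarith
  choose D f hf hsub using hpiece
  let e := (Denumerable.eqv (ℕ × ℕ × ℕ)).symm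
  refine ⟨fun k => D (e k), fun k => f (e k), fun k => hf _, fun x hx => ?_⟩
  obtain ⟨tx, htx, v, hv⟩ := h x hx
  obtain ⟨i, hi⟩ := hdense v (r / 2) (by positivity)
  obtain ⟨m, hm⟩ := exists_nat_one_div_lt htx
  have hb : ∀ t : ℝ, 0 < t → t ≤ 1 / ((m : ℝ) + 1) →
        Metric.ball (x + t • d i) (t * (r / 2)) ⊆ Sᶜ := by
    intro t ht htm
    refine (Metric.ball_subset_ball' ?_).trans (hv t ht (htm.trans hm.le))
    rw [dist_add_left, dist_smul₀, Real.norm_eq_abs, abs_of_pos ht, dist_comm]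
    nlinarith
  have hne : d i ≠ 0 := by
    intro h0
    refine hb _ (by positivity) le_rfl ?_ hx
    rw [h0]
    simp only [smul_zero, add_zero]
    exact Metric.mem_ball_self (by positivity)
  have hpos : 0 < ‖d i‖ := norm_pos_iff.2 hne
  obtain ⟨j, hj⟩ := hdense x (1 / ((m : ℝ) + 1) * ‖d i‖ / 2) (by positivity)
  refine Set.mem_iUnion.2 ⟨e.symm (i, m, j), ?_⟩
  simp only [Equiv.apply_symm_apply]
  exact hsub (i, m, j) ⟨hx, hb, hj.le⟩
end

section
/- Let n ≥ 1 and let B ⊆ ℝⁿ be a Lebesgue measurable set with the following property: for every x ∈ B there exist r > 0, α ∈ [−1, 1), and a unit vector v ∈ ℝⁿ such that (x + (Cone(v,α) ∩ B_r(0))) ∩ B = ∅. Then B has Lebesgue measure zero. -/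
open scoped RealInnerProductSpace
open MeasureTheory

/-- A Lebesgue measurable set `B ⊆ ℝⁿ` such that each of its points has
a truncated open cone `x + (Cone(v,α) ∩ B_r(0))` disjoint from `B` must be Lebesgue-null. -/
theorem null_of_cone_escape
    {n : ℕ} (hn : 1 ≤ n) (B : Set (EuclideanSpace ℝ (Fin n)))
    (hB : MeasurableSet B)
    (h : ∀ x ∈ B, ∃ r > (0 : ℝ), ∃ α : ℝ, -1 ≤ α ∧ α < 1 ∧
      ∃ v : EuclideanSpace ℝ (Fin n), ‖v‖ = 1 ∧
        ((fun w => x + w) '' (euclCone v α ∩ Metric.ball 0 r)) ∩ B = ∅) :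
    volume B = 0 := by
  have hae := Besicovitch.ae_tendsto_measure_inter_div
    (volume : Measure (EuclideanSpace ℝ (Fin n))) B
  rw [ae_restrict_iff' hB] at hae
  rw [measure_eq_zero_iff_ae_notMem]
  filter_upwards [hae] with x hx hxB
  obtain ⟨r, hr, α, -, hα, v, hv, hdisj⟩ := h x hxB
  have hopen : IsOpen (euclCone v α ∩ Metric.ball 0 r) := by
    refine IsOpen.inter ?_ Metric.isOpen_ball
    refine IsOpen.inter (s := {w | w ≠ 0}) (t := {w | α * ‖w‖ < ⟪v, w⟫}) isOpen_ne ?_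
    exact isOpen_lt (by fun_prop) (by fun_prop)
  have hne : (euclCone v α ∩ Metric.ball 0 r).Nonempty := by
    refine ⟨(r / 2) • v, ⟨?_, ?_⟩, ?_⟩
    · have : v ≠ 0 := by
        rintro rfl
        simp at hv
      exact smul_ne_zero (by positivity) this
    · rw [norm_smul, inner_smul_right, real_inner_self_eq_norm_sq, hv, Real.norm_eq_abs,
        abs_of_pos (by positivity)]
      nlinarith
    · rw [mem_ball_zero_iff, norm_smul, hv, Real.norm_eq_abs, abs_of_pos (by positivity)]
      linarith
  have hev := Measure.eventually_nonempty_inter_smul_of_density_one volume B x (hx hxB) _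
    hopen.measurableSet (hopen.measure_pos volume hne).ne'
  have h1 : ∀ᶠ s : ℝ in nhdsWithin 0 (Set.Ioi 0), s ∈ Set.Ioo (0 : ℝ) 1 :=
    Ioo_mem_nhdsGT one_pos
  obtain ⟨s, ⟨y, hyB, hy⟩, hs0, hs1⟩ := (hev.and h1).exists
  obtain ⟨x', hx', z, hz, rfl⟩ := Set.mem_add.1 hy
  obtain rfl := Set.mem_singleton_iff.1 hx'
  obtain ⟨w, ⟨⟨hw0, hw⟩, hwr⟩, rfl⟩ := Set.mem_smul_set.1 hz
  have : x' + s • w ∈ ((fun w => x' + w) '' (euclCone v α ∩ Metric.ball 0 r)) ∩ B := by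
    refine ⟨⟨s • w, ⟨⟨smul_ne_zero hs0.ne' hw0, ?_⟩, ?_⟩, rfl⟩, hyB⟩
    · rw [norm_smul, inner_smul_right, Real.norm_eq_abs, abs_of_pos hs0]
      nlinarith
    · rw [mem_ball_zero_iff] at hwr ⊢
      rw [norm_smul, Real.norm_eq_abs, abs_of_pos hs0]
      nlinarith [norm_nonneg w]
  rw [hdisj] at this
  exact this
end

section
/- Consider ℝ^{1+n} with the Minkowski bilinear form q(v,w) = −v₀w₀ + Σ_{i=1}^n v_i w_i, and define f(u) = −√(−q(u,u)) on the open set of timelike vectors {u : q(u,u) < 0}. Let v be timelike and let w ∈ ℝ^{1+n} not lie in the linear span of v. Then the function t ↦ f(v + tw) is twice differentiable at t = 0, its second derivative at t = 0 equals (−1/f(v)³)·(q(v,w)² − q(v,v)·q(w,w)), and this value is strictly positive. -/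
open Filter

/-- The Minkowski bilinear form on `ℝ^{1+n}`:
`q(v,w) = -v₀w₀ + ∑_{i=1}^n v_i w_i`. -/
def mink (n : ℕ) (v w : Fin (n + 1) → ℝ) : ℝ :=
  -(v 0 * w 0) + ∑ i : Fin n, v i.succ * w i.succ

lemma mink_expand (n : ℕ) (v w : Fin (n + 1) → ℝ) (s : ℝ) :
    mink n (v + s • w) (v + s • w) = mink n v v + 2 * mink n v w * s + mink n w w * s ^ 2 := by
  have h : ∑ i : Fin n, (v + s • w) i.succ * (v + s • w) i.succ
      = ∑ i : Fin n, v i.succ * v i.succ + 2 * s * ∑ i : Fin n, v i.succ * w i.succ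
        + s ^ 2 * ∑ i : Fin n, w i.succ * w i.succ := by
    rw [Finset.mul_sum, Finset.mul_sum, ← Finset.sum_add_distrib, ← Finset.sum_add_distrib]
    refine Finset.sum_congr rfl fun i _ => ?_
    simp only [Pi.add_apply, Pi.smul_apply, smul_eq_mul]
    ring
  unfold mink
  rw [h]
  simp only [Pi.add_apply, Pi.smul_apply, smul_eq_mul]
  ring

lemma mink_right (n : ℕ) (v w : Fin (n + 1) → ℝ) (s : ℝ) :
    mink n v (w + s • v) = mink n v w + s * mink n v v := by
  have h : ∑ i : Fin n, v i.succ * (w + s • v) i.succ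
      = ∑ i : Fin n, v i.succ * w i.succ + s * ∑ i : Fin n, v i.succ * v i.succ := by
    rw [Finset.mul_sum, ← Finset.sum_add_distrib]
    refine Finset.sum_congr rfl fun i _ => ?_
    simp only [Pi.add_apply, Pi.smul_apply, smul_eq_mul]
    ring
  unfold mink
  rw [h]
  simp only [Pi.add_apply, Pi.smul_apply, smul_eq_mul]
  ring

lemma mink_comm (n : ℕ) (v w : Fin (n + 1) → ℝ) : mink n v w = mink n w v := by
  unfold mink
  simp only [mul_comm]

lemma mink_orth_pos (n : ℕ) (v u : Fin (n + 1) → ℝ) (hv : mink n v v < 0)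
    (h0 : mink n v u = 0) (hu : u ≠ 0) : 0 < mink n u u := by
  unfold mink at *
  have cs := Finset.sum_mul_sq_le_sq_mul_sq Finset.univ (fun i : Fin n => v i.succ)
    (fun i : Fin n => u i.succ)
  simp only [pow_two (v _), pow_two (u _)] at cs
  have hV : 0 ≤ ∑ i : Fin n, v i.succ * v i.succ :=
    Finset.sum_nonneg fun i _ => mul_self_nonneg _
  have hU : 0 ≤ ∑ i : Fin n, u i.succ * u i.succ :=
    Finset.sum_nonneg fun i _ => mul_self_nonneg _
  have e : ∑ i : Fin n, v i.succ * u i.succ = v 0 * u 0 := by linarith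
  rw [e] at cs
  have hv0 : 0 < v 0 * v 0 := by linarith
  rcases hU.eq_or_lt with hU0 | hUp
  · exfalso
    apply hu
    rw [← hU0, mul_zero] at cs
    have h1 : v 0 * u 0 = 0 := by nlinarith
    have hvn : v 0 ≠ 0 := fun h => by simp [h] at hv0
    have h2 := (mul_eq_zero.mp h1).resolve_left hvn
    have h3 := (Finset.sum_eq_zero_iff_of_nonneg
      (fun (i : Fin n) _ => mul_self_nonneg (u i.succ))).mp hU0.symm
    funext i
    refine Fin.cases h2 (fun j => ?_) i
    exact mul_self_eq_zero.mp (h3 j (Finset.mem_univ _))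
  · have : v 0 * v 0 * (u 0 * u 0) < v 0 * v 0 * ∑ i : Fin n, u i.succ * u i.succ := by
      nlinarith
    have := lt_of_mul_lt_mul_left this hv0.le
    linarith

/-- For `f(u) = -√(-q(u,u))` on timelike vectors, `v` timelike and
`w ∉ span{v}`, the map `t ↦ f(v + t w)` is twice differentiable at `0`, its second
derivative there equals `(-1/f(v)³)(q(v,w)² - q(v,v)q(w,w))`, and this value is
strictly positive. -/
theorem minkowski_norm_second_derivative
    {n : ℕ} (v w : Fin (n + 1) → ℝ)
    (hv : mink n v v < 0)
    (hw : w ∉ Submodule.span ℝ ({v} : Set (Fin (n + 1) → ℝ))) :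
    ∃ g' : ℝ → ℝ,
      (∀ᶠ t in nhds (0 : ℝ),
        HasDerivAt (fun s : ℝ => -Real.sqrt (-(mink n (v + s • w) (v + s • w)))) (g' t) t) ∧
      HasDerivAt g'
        (-1 / (-Real.sqrt (-(mink n v v))) ^ 3 *
          (mink n v w ^ 2 - mink n v v * mink n w w)) 0 ∧
      0 < -1 / (-Real.sqrt (-(mink n v v))) ^ 3 *
          (mink n v w ^ 2 - mink n v v * mink n w w) := by
  have hpos : 0 < mink n v w ^ 2 - mink n v v * mink n w w := by
    have hu : w + (-(mink n v w / mink n v v)) • v ≠ 0 := by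
      intro h
      apply hw
      rw [Submodule.mem_span_singleton]
      refine ⟨mink n v w / mink n v v, ?_⟩
      rw [neg_smul, ← sub_eq_add_neg, sub_eq_zero] at h
      exact h.symm
    have h1 := mink_orth_pos n v _ hv (by rw [mink_right]; field_simp [hv.ne]; ring) hu
    rw [mink_expand, mink_comm n w v] at h1
    have h2 := mul_neg_of_neg_of_pos hv h1
    have h3 : mink n v v * (mink n w w + 2 * mink n v w * -(mink n v w / mink n v v)
        + mink n v v * (-(mink n v w / mink n v v)) ^ 2)
        = mink n v v * mink n w w - mink n v w ^ 2 := by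
      field_simp [hv.ne]
      ring
    linarith
  simp only [mink_expand]
  generalize mink n v v = a at *
  generalize mink n v w = b at *
  generalize mink n w w = c at *
  have hr : 0 < Real.sqrt (-a) := Real.sqrt_pos.mpr (by linarith)
  have hr2 : Real.sqrt (-a) ^ 2 = -a := Real.sq_sqrt (by linarith)
  have hQ : ∀ t : ℝ, HasDerivAt (fun s : ℝ => -(a + 2 * b * s + c * s ^ 2))
      (-(2 * b + c * (2 * t))) t := by
    intro t
    have h := ((((hasDerivAt_id t).const_mul (2 * b)).const_add a).add
      (((hasDerivAt_id t).pow 2).const_mul c)).neg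
    refine h.congr_deriv ?_
    simp
  have hS : ∀ t : ℝ, a + 2 * b * t + c * t ^ 2 < 0 →
      HasDerivAt (fun s : ℝ => Real.sqrt (-(a + 2 * b * s + c * s ^ 2)))
      (-((b + c * t) / Real.sqrt (-(a + 2 * b * t + c * t ^ 2)))) t := by
    intro t ht
    refine ((hQ t).sqrt (by linarith)).congr_deriv ?_
    have : 0 < Real.sqrt (-(a + 2 * b * t + c * t ^ 2)) := Real.sqrt_pos.mpr (by linarith)
    field_simp
  refine ⟨fun t => (b + c * t) / Real.sqrt (-(a + 2 * b * t + c * t ^ 2)), ?_, ?_, ?_⟩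
  · have hc : ContinuousAt (fun t : ℝ => a + 2 * b * t + c * t ^ 2) 0 := by fun_prop
    filter_upwards [hc.eventually_lt_const (u := 0) (by simpa using hv)] with t ht
    exact (hS t ht).neg.congr_deriv (neg_neg _)
  · have hN : HasDerivAt (fun t : ℝ => b + c * t) c 0 := by
      simpa using ((hasDerivAt_id (0 : ℝ)).const_mul c).const_add b
    have h := hN.div (hS 0 (by simpa using hv)) (by simpa using hr.ne')
    refine h.congr_deriv ?_
    have ha : a = -Real.sqrt (-a) ^ 2 := by linarith
    simp only [mul_zero, add_zero, ne_eq, OfNat.ofNat_ne_zero, not_false_eq_true, zero_pow]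
    generalize Real.sqrt (-a) = r at *
    subst ha
    field_simp
    ring
  · refine mul_pos ?_ hpos
    have : (-Real.sqrt (-a)) ^ 3 < 0 := Odd.pow_neg (by decide) (by linarith)
    exact div_pos_of_neg_of_neg (by norm_num) this
end
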